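/- For n ≥ 2 and every integer c with 0 ≤ c ≤ n−2, the number of full perfect matchings of 2n points on a circle having exactly C(n,2) − c crossing pairs equals the binomial coefficient C(n−1+c, c). In particular, every perfect matching of 2n points with at least C(n,2) − (n−2) crossing pairs is full. -/

import Mathlib

/-- `M` is a perfect matching of the `2n` points `0, 1, …, 2n-1` placed in clockwise
order on a circle: a set of pairwise disjoint unordered pairs covering all `2n` points. -/
def IsPerfectMatching (n : ℕ) (M : Finset (Finset ℕ)) : Prop :=
  (∀ p ∈ M, p.card = 2) ∧
  (∀ p ∈ M, ∀ x ∈ p, x < 2 * n) ∧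
  (∀ p ∈ M, ∀ q ∈ M, p ≠ q → Disjoint p q) ∧
  (∀ x, x < 2 * n → ∃ p ∈ M, x ∈ p)

/-- The chord `V_i V_j` (where the boundary vertex `V_i` lies between points `2i-2` and
`2i-1`, and `1 ≤ i < j ≤ n`) is a dividing line for `M` if no pair of `M` has exactly one
element in `{2i-1, …, 2j-2}`. -/
def IsDividingLine (n i j : ℕ) (M : Finset (Finset ℕ)) : Prop :=
  1 ≤ i ∧ i < j ∧ j ≤ n ∧
    ∀ p ∈ M, (p ∩ Finset.Icc (2 * i - 1) (2 * j - 2)).card ≠ 1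

/-- `M` is full if it has no dividing line. -/
def IsFull (n : ℕ) (M : Finset (Finset ℕ)) : Prop :=
  ∀ i j, ¬ IsDividingLine n i j M


/-- Two pairs cross if their endpoints interleave around the circle, i.e. they can be
written as `{a,b}` and `{c,d}` with `a < c < b < d`. -/
def Crosses (p q : Finset ℕ) : Prop :=
  ∃ a b c d : ℕ, a < c ∧ c < b ∧ b < d ∧
    ((p = {a, b} ∧ q = {c, d}) ∨ (p = {c, d} ∧ q = {a, b}))

/-- The number of (unordered) crossing pairs of chords of `M`. -/
noncomputable def crossingCount (M : Finset (Finset ℕ)) : ℕ :=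
  Set.ncard {s : Finset (Finset ℕ) | ∃ p ∈ M, ∃ q ∈ M, Crosses p q ∧ s = {p, q}}

section MatchingPolynomials

open PowerSeries

/-- The generating function, by number of non-crossing pairs of chords, of the ways to complete
`h` open chords and `r` chords yet to be opened to a perfect matching. -/
noncomputable def completionGF : ℕ → ℕ → ℤ⟦X⟧
  | 0, 0 => 1
  | 0, h + 1 => (∑ k ∈ Finset.range (h + 1), X ^ k) * completionGF 0 h
  | r + 1, 0 => completionGF r 1
  | r + 1, h + 1 => completionGF r (h + 2) +
      X ^ (r + 1) * (∑ k ∈ Finset.range (h + 1), X ^ k) * completionGF (r + 1) h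

theorem one_sub_X_mul_geom (h : ℕ) :
    (1 - X : ℤ⟦X⟧) * ∑ k ∈ Finset.range h, X ^ k = 1 - X ^ h :=
  mul_neg_geom_sum X h

theorem one_sub_X_pow_mul_completionGF_zero (h : ℕ) :
    (1 - X) ^ h * completionGF 0 h = ∏ i ∈ Finset.range h, (1 - X ^ (i + 1)) := by
  induction h with
  | zero => simp [completionGF]
  | succ h ih =>
    rw [completionGF, Finset.prod_range_succ, ← ih, ← one_sub_X_mul_geom (h + 1)]
    ring

theorem X_pow_dvd_completionGF_sub (r h : ℕ) :
    (X : ℤ⟦X⟧) ^ (r + h) ∣ (1 - X) ^ (r + h) * completionGF r h -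
      ∏ i ∈ Finset.range h, (1 - X ^ (r + i + 1)) := by
  induction r generalizing h with
  | zero => simp [one_sub_X_pow_mul_completionGF_zero]
  | succ r ihr =>
    induction h with
    | zero =>
      obtain ⟨u, hu⟩ := ihr 1
      refine ⟨u - 1, ?_⟩
      simp only [completionGF, Finset.prod_range_succ, Finset.range_zero, Finset.prod_empty,
        add_zero] at hu ⊢
      linear_combination hu
    | succ h ihh =>
      obtain ⟨u, hu⟩ := ihr (h + 2)
      obtain ⟨v, hv⟩ := ihh
      rw [Finset.prod_range_succ'] at hu
      rw [completionGF, Finset.prod_range_succ]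
      have hg := one_sub_X_mul_geom (h + 1)
      simp only [show ∀ i, r + (i + 1) + 1 = r + 1 + i + 1 by intro i; ring] at hu
      rw [Finset.prod_range_succ] at hu
      set P : ℤ⟦X⟧ := ∏ i ∈ Finset.range h, (1 - X ^ (r + 1 + i + 1))
      set G : ℤ⟦X⟧ := ∑ k ∈ Finset.range (h + 1), X ^ k
      refine ⟨u + X ^ r * (1 - X ^ (h + 1)) * v - P + X ^ (r + 1) * P, ?_⟩
      have e1 : r + (h + 2) = r + 1 + (h + 1) := by ring
      rw [e1] at hu
      linear_combination hu + X ^ (r + 1) * (1 - X ^ (h + 1)) * hv +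
        X ^ (r + 1) * (1 - X) ^ (r + 1 + h) * completionGF (r + 1) h * hg

theorem coeff_completionGF (n c : ℕ) (hc : c < n) :
    coeff c (completionGF n 0) = ((n - 1 + c).choose c : ℤ) := by
  obtain ⟨d, rfl⟩ : ∃ d, n = d + 1 := ⟨n - 1, by omega⟩
  obtain ⟨u, hu⟩ := X_pow_dvd_completionGF_sub (d + 1) 0
  simp only [Finset.range_zero, Finset.prod_empty, add_zero] at hu
  have h1 := (invOneSubPow ℤ (d + 1)).val_inv
  rw [invOneSubPow_inv_eq_one_sub_pow] at h1
  have h2 : completionGF (d + 1) 0 = (invOneSubPow ℤ (d + 1)).val +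
      X ^ (d + 1) * (u * (invOneSubPow ℤ (d + 1)).val) := by
    linear_combination (invOneSubPow ℤ (d + 1)).val * hu - completionGF (d + 1) 0 * h1
  rw [h2, map_add, coeff_X_pow_mul', if_neg (by omega), add_zero,
    invOneSubPow_val_succ_eq_mk_add_choose, coeff_mk, Nat.add_sub_cancel]
  rw [Nat.choose_symm_add]

end MatchingPolynomials

theorem Crosses.symm {p q : Finset ℕ} (h : Crosses p q) : Crosses q p := by
  obtain ⟨a, b, c, d, h1, h2, h3, h⟩ := h
  exact ⟨a, b, c, d, h1, h2, h3, h.symm.imp And.symm And.symm⟩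

theorem not_crosses_self (p : Finset ℕ) : ¬ Crosses p p := by
  rintro ⟨a, b, c, d, h1, h2, h3, ⟨rfl, h⟩ | ⟨rfl, h⟩⟩
  · have : a ∈ ({c, d} : Finset ℕ) := h ▸ by simp
    simp at this
    omega
  · have : a ∈ ({c, d} : Finset ℕ) := h ▸ by simp
    simp at this
    omega

theorem crosses_of_lt {a b c d : ℕ} (h1 : a < c) (h2 : c < b) (h3 : b < d) :
    Crosses {a, b} {c, d} :=
  ⟨a, b, c, d, h1, h2, h3, Or.inl ⟨rfl, rfl⟩⟩

theorem crossing_pairs_subset_powersetCard (M : Finset (Finset ℕ)) :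
    {s : Finset (Finset ℕ) | ∃ p ∈ M, ∃ q ∈ M, Crosses p q ∧ s = {p, q}} ⊆
      (M.powersetCard 2 : Set (Finset (Finset ℕ))) := by
  rintro s ⟨p, hp, q, hq, h, rfl⟩
  have hne : p ≠ q := by
    rintro rfl
    exact not_crosses_self p h
  simp only [Finset.mem_coe, Finset.mem_powersetCard, Finset.card_pair hne, and_true]
  intro x hx
  simp only [Finset.mem_insert, Finset.mem_singleton] at hx
  rcases hx with rfl | rfl <;> assumption

theorem finite_crossing_pairs (M : Finset (Finset ℕ)) :
    {s : Finset (Finset ℕ) | ∃ p ∈ M, ∃ q ∈ M, Crosses p q ∧ s = {p, q}}.Finite :=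
  (Finset.finite_toSet _).subset (crossing_pairs_subset_powersetCard M)

theorem crossingCount_le (M : Finset (Finset ℕ)) : crossingCount M ≤ M.card.choose 2 := by
  rw [← Finset.card_powersetCard, ← Set.ncard_coe_finset]
  exact Set.ncard_le_ncard (crossing_pairs_subset_powersetCard M) (Finset.finite_toSet _)

open Classical in
theorem crossingCount_insert {p : Finset ℕ} {M : Finset (Finset ℕ)} (hp : p ∉ M) :
    crossingCount (insert p M) = crossingCount M + (M.filter (Crosses p)).card := by
  have himg : (M.filter (Crosses p)).card =
      ((fun q => ({p, q} : Finset (Finset ℕ))) '' (M.filter (Crosses p) : Set _)).ncard := by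
    rw [Set.InjOn.ncard_image, Set.ncard_coe_finset]
    intro q hq q' hq' h
    simp only [Finset.coe_filter, Set.mem_ofPred_eq] at hq hq'
    have : q ∈ ({p, q'} : Finset (Finset ℕ)) := by
      have h' : ({p, q} : Finset (Finset ℕ)) = {p, q'} := h
      rw [← h']
      simp
    simp only [Finset.mem_insert, Finset.mem_singleton] at this
    rcases this with rfl | rfl
    · exact absurd hq.1 hp
    · rfl
  rw [himg, crossingCount, crossingCount, ← Set.ncard_union_eq ?_ (finite_crossing_pairs M)
    ((Finset.finite_toSet _).image _)]
  · congr 1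
    ext s
    simp only [Finset.mem_insert, Set.mem_ofPred_eq, Set.mem_union, Set.mem_image,
      Finset.coe_filter]
    constructor
    · rintro ⟨a, rfl | ha, b, rfl | hb, h, rfl⟩
      · exact absurd h (not_crosses_self _)
      · exact Or.inr ⟨b, ⟨hb, h⟩, rfl⟩
      · exact Or.inr ⟨a, ⟨ha, h.symm⟩, Finset.pair_comm _ _⟩
      · exact Or.inl ⟨a, ha, b, hb, h, rfl⟩
    · rintro (⟨a, ha, b, hb, h, rfl⟩ | ⟨b, ⟨hb, h⟩, rfl⟩)
      · exact ⟨a, Or.inr ha, b, Or.inr hb, h, rfl⟩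
      · exact ⟨p, Or.inl rfl, b, Or.inr hb, h, rfl⟩
  · rw [Set.disjoint_left]
    rintro s hs ⟨q, -, rfl⟩
    have := crossing_pairs_subset_powersetCard M hs
    simp only [Finset.mem_coe, Finset.mem_powersetCard] at this
    exact hp (this.1 (by simp))

/-- `M` is a perfect matching of the finite set `S` of points. -/
def IsMatchingOn (S : Finset ℕ) (M : Finset (Finset ℕ)) : Prop :=
  (∀ p ∈ M, p.card = 2) ∧ (∀ p ∈ M, p ⊆ S) ∧
    (∀ p ∈ M, ∀ q ∈ M, p ≠ q → Disjoint p q) ∧ (∀ x ∈ S, ∃ p ∈ M, x ∈ p)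

theorem isPerfectMatching_iff (n : ℕ) (M : Finset (Finset ℕ)) :
    IsPerfectMatching n M ↔ IsMatchingOn (Finset.range (2 * n)) M := by
  simp only [IsPerfectMatching, IsMatchingOn, Finset.subset_iff, Finset.mem_range]

namespace IsMatchingOn

variable {S : Finset ℕ} {M : Finset (Finset ℕ)}

theorem eq_of_mem (h : IsMatchingOn S M) {p q : Finset ℕ} (hp : p ∈ M) (hq : q ∈ M) {x : ℕ}
    (hxp : x ∈ p) (hxq : x ∈ q) : p = q := by
  by_contra hne
  exact Finset.disjoint_left.1 (h.2.2.1 p hp q hq hne) hxp hxq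

theorem sum_card_inter (h : IsMatchingOn S M) {T : Finset ℕ} (hT : T ⊆ S) :
    ∑ p ∈ M, (p ∩ T).card = T.card := by
  rw [← Finset.card_biUnion]
  · congr 1
    ext x
    simp only [Finset.mem_biUnion, Finset.mem_inter]
    constructor
    · rintro ⟨p, -, -, hx⟩
      exact hx
    · intro hx
      obtain ⟨p, hp, hxp⟩ := h.2.2.2 x (hT hx)
      exact ⟨p, hp, hxp, hx⟩
  · intro p hp q hq hne
    exact (h.2.2.1 p hp q hq hne).mono Finset.inter_subset_left Finset.inter_subset_left

theorem two_mul_card (h : IsMatchingOn S M) : 2 * M.card = S.card := by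
  rw [← h.sum_card_inter subset_rfl, mul_comm, ← smul_eq_mul, ← Finset.sum_const]
  refine Finset.sum_congr rfl fun p hp => ?_
  rw [Finset.inter_eq_left.2 (h.2.1 p hp), h.1 p hp]

theorem erase (h : IsMatchingOn S M) {p : Finset ℕ} (hp : p ∈ M) :
    IsMatchingOn (S \ p) (M.erase p) := by
  refine ⟨fun q hq => h.1 q (Finset.mem_of_mem_erase hq), fun q hq => ?_,
    fun q hq q' hq' => h.2.2.1 q (Finset.mem_of_mem_erase hq) q' (Finset.mem_of_mem_erase hq'),
    fun x hx => ?_⟩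
  · rw [Finset.mem_erase] at hq
    exact Finset.subset_sdiff.2 ⟨h.2.1 q hq.2, h.2.2.1 q hq.2 p hp hq.1⟩
  · rw [Finset.mem_sdiff] at hx
    obtain ⟨q, hq, hxq⟩ := h.2.2.2 x hx.1
    refine ⟨q, Finset.mem_erase.2 ⟨?_, hq⟩, hxq⟩
    rintro rfl
    exact hx.2 hxq

theorem insert {p : Finset ℕ} (hpS : p ⊆ S) (hp : p.card = 2) (h : IsMatchingOn (S \ p) M) :
    IsMatchingOn S (insert p M) := by
  have hd : ∀ q ∈ M, Disjoint q p := fun q hq => (Finset.subset_sdiff.1 (h.2.1 q hq)).2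
  refine ⟨?_, ?_, ?_, ?_⟩
  · simpa [hp] using h.1
  · simpa [hpS] using fun q hq => (Finset.subset_sdiff.1 (h.2.1 q hq)).1
  · intro q hq q' hq' hne
    rcases Finset.mem_insert.1 hq with h1 | h1 <;> rcases Finset.mem_insert.1 hq' with h2 | h2
    · exact absurd (h1.trans h2.symm) hne
    · exact h1 ▸ (hd _ h2).symm
    · exact h2 ▸ hd _ h1
    · exact h.2.2.1 q h1 q' h2 hne
  · intro x hx
    by_cases hxp : x ∈ p
    · exact ⟨p, Finset.mem_insert_self _ _, hxp⟩
    · obtain ⟨q, hq, hxq⟩ := h.2.2.2 x (Finset.mem_sdiff.2 ⟨hx, hxp⟩)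
      exact ⟨q, Finset.mem_insert_of_mem hq, hxq⟩

theorem notMem_of_sdiff {p : Finset ℕ} (hp : p.Nonempty) (h : IsMatchingOn (S \ p) M) :
    p ∉ M := by
  intro hpM
  obtain ⟨x, hx⟩ := hp
  exact (Finset.mem_sdiff.1 (h.2.1 p hpM hx)).2 hx

end IsMatchingOn

theorem Finset.eq_pair_of_card_two_of_mem {p : Finset ℕ} (hp : p.card = 2) {j : ℕ} (hj : j ∈ p) :
    ∃ d, d ≠ j ∧ p = {j, d} := by
  obtain ⟨a, b, hab, rfl⟩ := Finset.card_eq_two.1 hp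
  simp only [Finset.mem_insert, Finset.mem_singleton] at hj
  rcases hj with rfl | rfl
  · exact ⟨b, hab.symm, rfl⟩
  · exact ⟨a, hab, Finset.pair_comm _ _⟩

open Classical in
/-- The perfect matchings of `S` none of whose chords has both ends in `H`. -/
noncomputable def matchingsAvoiding (S H : Finset ℕ) : Finset (Finset (Finset ℕ)) :=
  S.powerset.powerset.filter fun M => IsMatchingOn S M ∧ ∀ p ∈ M, ¬ p ⊆ H

theorem mem_matchingsAvoiding {S H : Finset ℕ} {M : Finset (Finset ℕ)} :
    M ∈ matchingsAvoiding S H ↔ IsMatchingOn S M ∧ ∀ p ∈ M, ¬ p ⊆ H := by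
  simp only [matchingsAvoiding, Finset.mem_filter, and_iff_right_iff_imp, Finset.mem_powerset]
  exact fun h p hp => Finset.mem_powerset.2 (h.1.2.1 p hp)

open Classical in
theorem card_filter_crosses {S H : Finset ℕ} {M : Finset (Finset ℕ)} {i x : ℕ} (hHS : H ⊆ S)
    (hx : x ∈ S \ H) (hmin : ∀ y ∈ S \ H, x ≤ y) (hlow : ∀ j ∈ H, ∀ y ∈ S \ H, j < y)
    (hi : i ∈ H) (hM : IsMatchingOn (S \ {i, x}) M) (hMH : ∀ p ∈ M, ¬ p ⊆ H.erase i) :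
    (M.filter (Crosses {i, x})).card = (H.filter (i < ·)).card := by
  have hMH' : ∀ p ∈ M, ¬ p ⊆ H := by
    intro p hp hpH
    refine hMH p hp (Finset.subset_erase.2 ⟨hpH, fun hip => ?_⟩)
    have := hM.2.1 p hp hip
    simp at this
  have hpart : ∀ p ∈ M, ∀ j ∈ p, j ∈ H → ∃ d, p = {j, d} ∧ x < d ∧ d ∉ H := by
    intro p hp j hjp hj
    obtain ⟨d, hdj, rfl⟩ := Finset.eq_pair_of_card_two_of_mem (hM.1 p hp) hjp
    have hdH : d ∉ H := fun hd => hMH' _ hp (by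
      intro y hy
      simp only [Finset.mem_insert, Finset.mem_singleton] at hy
      rcases hy with rfl | rfl <;> assumption)
    have hd := hM.2.1 _ hp (show d ∈ ({j, d} : Finset ℕ) by simp)
    simp only [Finset.mem_sdiff, Finset.mem_insert, Finset.mem_singleton, not_or] at hd
    have := hmin d (Finset.mem_sdiff.2 ⟨hd.1, hdH⟩)
    exact ⟨d, rfl, by omega, hdH⟩
  have hex : ∀ j ∈ H.filter (i < ·), ∃ p ∈ M, j ∈ p := by
    intro j hj
    rw [Finset.mem_filter] at hj
    refine hM.2.2.2 j ?_
    have := hlow j hj.1 x hx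
    simp only [Finset.mem_sdiff, Finset.mem_insert, Finset.mem_singleton, not_or]
    exact ⟨hHS hj.1, by omega, by omega⟩
  choose! f hfM hf using hex
  symm
  refine Finset.card_bij (fun j _ => f j) ?_ ?_ ?_
  · intro j hj
    have hj' := Finset.mem_filter.1 hj
    obtain ⟨d, hd, hxd, -⟩ := hpart _ (hfM j hj) j (hf j hj) hj'.1
    refine Finset.mem_filter.2 ⟨hfM j hj, ?_⟩
    rw [hd]
    exact crosses_of_lt hj'.2 (hlow j hj'.1 x hx) hxd
  · intro j hj j' hj' h
    obtain ⟨d, hd, -, hdH⟩ := hpart _ (hfM j hj) j (hf j hj) (Finset.mem_filter.1 hj).1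
    have h2 := hf j' hj'
    rw [← h, hd] at h2
    simp only [Finset.mem_insert, Finset.mem_singleton] at h2
    rcases h2 with h2 | h2
    · exact h2.symm
    · exact absurd (h2 ▸ (Finset.mem_filter.1 hj').1) hdH
  · intro p hp
    obtain ⟨hpM, a, b, c, d, hac, hcb, hbd, h⟩ := Finset.mem_filter.1 hp
    have hix := hlow i hi x hx
    rcases h with ⟨h, rfl⟩ | ⟨h, rfl⟩
    · have ha : a ∈ ({i, x} : Finset ℕ) := h ▸ by simp
      have hb : b ∈ ({i, x} : Finset ℕ) := h ▸ by simp
      simp only [Finset.mem_insert, Finset.mem_singleton] at ha hb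
      obtain rfl : a = i := by omega
      obtain rfl : b = x := by omega
      have hcS := hM.2.1 _ hpM (show c ∈ ({c, d} : Finset ℕ) by simp)
      have hcH : c ∈ H := by
        by_contra hc
        have := hmin c (Finset.mem_sdiff.2 ⟨(Finset.mem_sdiff.1 hcS).1, hc⟩)
        omega
      have hc' : c ∈ H.filter (a < ·) := Finset.mem_filter.2 ⟨hcH, hac⟩
      exact ⟨c, hc', hM.eq_of_mem (hfM c hc') hpM (hf c hc') (by simp)⟩
    · have ha : c ∈ ({i, x} : Finset ℕ) := h ▸ by simp
      have hb : d ∈ ({i, x} : Finset ℕ) := h ▸ by simp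
      simp only [Finset.mem_insert, Finset.mem_singleton] at ha hb
      obtain rfl : c = i := by omega
      obtain rfl : d = x := by omega
      exfalso
      refine hMH' _ hpM fun y hy => ?_
      by_contra hyH
      have h1 := hmin y (Finset.mem_sdiff.2 ⟨(Finset.mem_sdiff.1 (hM.2.1 _ hpM hy)).1, hyH⟩)
      simp only [Finset.mem_insert, Finset.mem_singleton] at hy
      omega

theorem Finset.sum_card_filter_lt {α : Type*} [AddCommMonoid α] (H : Finset ℕ) (φ : ℕ → α) :
    ∑ i ∈ H, φ (H.filter (i < ·)).card = ∑ k ∈ Finset.range H.card, φ k := by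
  induction H using Finset.induction_on_min with
  | empty => simp
  | insert a s hs ih =>
    have ha : a ∉ s := fun h => lt_irrefl _ (hs a h)
    rw [Finset.sum_insert ha, Finset.card_insert_of_notMem ha, Finset.sum_range_succ, ← ih,
      add_comm]
    congr 1
    · refine Finset.sum_congr rfl fun i hi => ?_
      rw [Finset.filter_insert, if_neg (hs i hi).le.not_gt]
    · rw [Finset.filter_insert, if_neg (lt_irrefl a), Finset.filter_true_of_mem hs]

section MatchingGF

open PowerSeries

/-- The generating function of `matchingsAvoiding S H` by number of non-crossing pairs. -/
noncomputable def matchingGF (S H : Finset ℕ) : ℤ⟦X⟧ :=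
  ∑ M ∈ matchingsAvoiding S H, X ^ (M.card.choose 2 - crossingCount M)

theorem sum_filter_pair_mem {S H : Finset ℕ} {n x i : ℕ} (hS : S.card = 2 * (n + 1))
    (hHS : H ⊆ S) (hx : x ∈ S \ H) (hmin : ∀ y ∈ S \ H, x ≤ y)
    (hlow : ∀ j ∈ H, ∀ y ∈ S \ H, j < y) (hi : i ∈ H) :
    ∑ M ∈ (matchingsAvoiding S H).filter ({i, x} ∈ ·),
        (X : ℤ⟦X⟧) ^ (M.card.choose 2 - crossingCount M) =
      X ^ (n - (H.filter (i < ·)).card) * matchingGF (S \ {i, x}) (H.erase i) := by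
  classical
  have hix := hlow i hi x hx
  have hxS := Finset.mem_sdiff.1 hx
  have hpS : ({i, x} : Finset ℕ) ⊆ S := by
    simp [Finset.insert_subset_iff, hHS hi, hxS.1]
  have hp2 : ({i, x} : Finset ℕ).card = 2 := Finset.card_pair hix.ne
  have hpne : ({i, x} : Finset ℕ).Nonempty := ⟨i, by simp⟩
  rw [matchingGF, Finset.mul_sum]
  refine Finset.sum_bij' (fun M _ => M.erase {i, x}) (fun M _ => insert {i, x} M) ?_ ?_ ?_ ?_ ?_
  · intro M hM
    obtain ⟨hM, hpM⟩ := Finset.mem_filter.1 hM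
    rw [mem_matchingsAvoiding] at hM ⊢
    exact ⟨hM.1.erase hpM, fun p hp hpH =>
      hM.2 p (Finset.mem_of_mem_erase hp) (hpH.trans (Finset.erase_subset _ _))⟩
  · intro M hM
    rw [mem_matchingsAvoiding] at hM
    refine Finset.mem_filter.2 ⟨mem_matchingsAvoiding.2 ⟨hM.1.insert hpS hp2, ?_⟩, by simp⟩
    intro p hp hpH
    rcases Finset.mem_insert.1 hp with rfl | hp
    · exact hxS.2 (hpH (by simp))
    · refine hM.2 p hp (Finset.subset_erase.2 ⟨hpH, fun hip => ?_⟩)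
      have := hM.1.2.1 p hp hip
      simp at this
  · intro M hM
    exact Finset.insert_erase (Finset.mem_filter.1 hM).2
  · intro M hM
    exact Finset.erase_insert ((mem_matchingsAvoiding.1 hM).1.notMem_of_sdiff hpne)
  · intro M hM
    obtain ⟨hM, hpM⟩ := Finset.mem_filter.1 hM
    rw [mem_matchingsAvoiding] at hM
    have hN := hM.1.erase hpM
    obtain ⟨N, rfl, hpN⟩ : ∃ N, M = insert {i, x} N ∧ {i, x} ∉ N :=
      ⟨M.erase {i, x}, (Finset.insert_erase hpM).symm, Finset.notMem_erase _ _⟩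
    rw [Finset.erase_insert hpN] at hN ⊢
    have hcard := hM.1.two_mul_card
    rw [Finset.card_insert_of_notMem hpN] at hcard
    have hcr := crossingCount_insert hpN
    have hle := Finset.card_filter_le N (Crosses {i, x})
    rw [card_filter_crosses hHS hx hmin hlow hi hN fun p hp hpH =>
      hM.2 p (Finset.mem_insert_of_mem hp) (hpH.trans (Finset.erase_subset _ _))] at hcr hle
    rw [← pow_add, Finset.card_insert_of_notMem hpN, hcr, Nat.choose_succ_succ' N.card 1,
      Nat.choose_one_right, one_add_one_eq_two]
    have := crossingCount_le N
    congr 1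
    omega

theorem matchingGF_eq_add_sum {S H : Finset ℕ} {n x : ℕ} (hS : S.card = 2 * (n + 1))
    (hHS : H ⊆ S) (hx : x ∈ S \ H) (hmin : ∀ y ∈ S \ H, x ≤ y)
    (hlow : ∀ j ∈ H, ∀ y ∈ S \ H, j < y) :
    matchingGF S H = matchingGF S (insert x H) +
      ∑ i ∈ H, X ^ (n - (H.filter (i < ·)).card) * matchingGF (S \ {i, x}) (H.erase i) := by
  classical
  have hxH := (Finset.mem_sdiff.1 hx).2
  rw [matchingGF, ← Finset.sum_filter_add_sum_filter_not _ (fun M => ∃ i ∈ H, {i, x} ∈ M),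
    add_comm]
  congr 1
  · rw [matchingGF]
    congr 1
    ext M
    simp only [Finset.mem_filter, mem_matchingsAvoiding, not_exists, not_and]
    constructor
    · rintro ⟨⟨hM, hMH⟩, h⟩
      refine ⟨hM, fun p hp hpH => ?_⟩
      have hxp : x ∈ p := by
        by_contra hxp
        refine hMH p hp fun y hy => ?_
        rcases Finset.mem_insert.1 (hpH hy) with rfl | hyH
        · exact absurd hy hxp
        · exact hyH
      obtain ⟨d, hd, rfl⟩ := Finset.eq_pair_of_card_two_of_mem (hM.1 p hp) hxp
      have hdH := Finset.mem_of_mem_insert_of_ne (hpH (by simp : d ∈ _)) hd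
      exact h d hdH (Finset.pair_comm x d ▸ hp)
    · rintro ⟨hM, hMH⟩
      refine ⟨⟨hM, fun p hp hpH => hMH p hp (hpH.trans (Finset.subset_insert _ _))⟩, ?_⟩
      intro i hi hp
      refine hMH _ hp fun y hy => ?_
      simp only [Finset.mem_insert, Finset.mem_singleton] at hy ⊢
      rcases hy with rfl | rfl
      · exact Or.inr hi
      · exact Or.inl rfl
  · have hU : (matchingsAvoiding S H).filter (fun M => ∃ i ∈ H, {i, x} ∈ M) =
        H.biUnion fun i => (matchingsAvoiding S H).filter ({i, x} ∈ ·) := by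
      ext M
      simp only [Finset.mem_filter, Finset.mem_biUnion]
      tauto
    rw [hU, Finset.sum_biUnion]
    · exact Finset.sum_congr rfl fun i hi => sum_filter_pair_mem hS hHS hx hmin hlow hi
    · intro i hi j hj hij
      rw [Function.onFun, Finset.disjoint_left]
      intro M hM hM'
      simp only [Finset.mem_filter, mem_matchingsAvoiding] at hM hM'
      have h := hM.1.1.eq_of_mem hM.2 hM'.2 (x := x) (by simp) (by simp)
      have hi' : i ∈ ({j, x} : Finset ℕ) := h ▸ by simp
      simp only [Finset.mem_insert, Finset.mem_singleton] at hi'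
      rcases hi' with h' | h'
      · exact hij h'
      · exact hxH (h' ▸ hi)

theorem matchingGF_eq_zero {S H : Finset ℕ} (hHS : H ⊆ S) (hcard : S.card < 2 * H.card) :
    matchingGF S H = 0 := by
  rw [matchingGF, Finset.sum_eq_zero]
  intro M hM
  rw [mem_matchingsAvoiding] at hM
  exfalso
  have h1 := hM.1.two_mul_card
  have h2 := hM.1.sum_card_inter hHS
  have h3 : ∑ p ∈ M, (p ∩ H).card ≤ ∑ p ∈ M, 1 := by
    refine Finset.sum_le_sum fun p hp => ?_
    by_contra hlt
    refine hM.2 p hp (Finset.inter_eq_left.1 (Finset.eq_of_subset_of_card_le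
      Finset.inter_subset_left ?_))
    rw [hM.1.1 p hp]
    omega
  rw [Finset.sum_const, smul_eq_mul, mul_one] at h3
  omega

theorem matchingGF_empty : matchingGF ∅ ∅ = 1 := by
  have : matchingsAvoiding ∅ ∅ = {∅} := by
    ext M
    rw [mem_matchingsAvoiding, Finset.mem_singleton]
    constructor
    · rintro ⟨h, -⟩
      have := h.two_mul_card
      simpa using this
    · rintro rfl
      simp [IsMatchingOn]
  rw [matchingGF, this]
  simp

theorem sum_X_pow_sub (r h : ℕ) :
    ∑ k ∈ Finset.range (h + 1), (X : ℤ⟦X⟧) ^ (r + h - k) =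
      X ^ r * ∑ k ∈ Finset.range (h + 1), X ^ k := by
  rw [← Finset.sum_range_reflect, Finset.mul_sum]
  refine Finset.sum_congr rfl fun k hk => ?_
  rw [Finset.mem_range] at hk
  rw [← pow_add]
  congr 1
  omega

theorem matchingGF_eq_completionGF (r h : ℕ) (S H : Finset ℕ) (hS : S.card = 2 * (r + h))
    (hH : H.card = h) (hHS : H ⊆ S) (hlow : ∀ j ∈ H, ∀ y ∈ S \ H, j < y) :
    matchingGF S H = completionGF r h := by
  have hnext : (S \ H).Nonempty → ∃ x ∈ S \ H, ∀ y ∈ S \ H, x ≤ y := fun hne =>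
    ⟨(S \ H).min' hne, Finset.min'_mem _ _, fun y hy => Finset.min'_le _ y hy⟩
  have hinsert : ∀ x ∈ S \ H, (∀ y ∈ S \ H, x ≤ y) →
      insert x H ⊆ S ∧ (insert x H).card = h + 1 ∧
        ∀ j ∈ insert x H, ∀ y ∈ S \ insert x H, j < y := by
    intro x hx hmin
    refine ⟨Finset.insert_subset (Finset.mem_sdiff.1 hx).1 hHS,
      by rw [Finset.card_insert_of_notMem (Finset.mem_sdiff.1 hx).2, hH], fun j hj y hy => ?_⟩
    simp only [Finset.mem_sdiff, Finset.mem_insert, not_or] at hy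
    have hy' := Finset.mem_sdiff.2 ⟨hy.1, hy.2.2⟩
    rcases Finset.mem_insert.1 hj with rfl | hj
    · exact lt_of_le_of_ne (hmin y hy') (Ne.symm hy.2.1)
    · exact hlow j hj y hy'
  have herase : ∀ x ∈ S \ H, ∀ i ∈ H, ∀ g, h = g + 1 →
      (S \ {i, x}).card = 2 * (r + g) ∧ (H.erase i).card = g ∧ H.erase i ⊆ S \ {i, x} ∧
        ∀ j ∈ H.erase i, ∀ y ∈ (S \ {i, x}) \ H.erase i, j < y := by
    intro x hx i hi g hg
    have hix := hlow i hi x hx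
    have hxS := Finset.mem_sdiff.1 hx
    refine ⟨?_, ?_, ?_, ?_⟩
    · rw [Finset.card_sdiff_of_subset (by simp [Finset.insert_subset_iff, hHS hi, hxS.1]),
        Finset.card_pair hix.ne, hS]
      omega
    · rw [Finset.card_erase_of_mem hi, hH]
      omega
    · intro y hy
      rw [Finset.mem_erase] at hy
      simp only [Finset.mem_sdiff, Finset.mem_insert, Finset.mem_singleton, not_or]
      exact ⟨hHS hy.2, hy.1, (hlow y hy.2 x hx).ne⟩
    · intro j hj y hy
      simp only [Finset.mem_sdiff, Finset.mem_insert, Finset.mem_singleton, not_or,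
        Finset.mem_erase, not_and] at hy
      exact hlow j (Finset.mem_of_mem_erase hj) y
        (Finset.mem_sdiff.2 ⟨hy.1.1, hy.2 hy.1.2.1⟩)
  have hcard := Finset.card_sdiff_add_card_eq_card hHS
  match r, h with
  | 0, 0 =>
    obtain rfl : S = ∅ := Finset.card_eq_zero.1 (by omega)
    obtain rfl : H = ∅ := Finset.card_eq_zero.1 hH
    rw [matchingGF_empty, completionGF]
  | 0, h + 1 =>
    obtain ⟨x, hx, hmin⟩ := hnext (Finset.card_pos.1 (by omega))
    obtain ⟨h1, h2, h3⟩ := hinsert x hx hmin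
    rw [matchingGF_eq_add_sum (n := h) (by omega) hHS hx hmin hlow,
      matchingGF_eq_zero h1 (by omega), zero_add, completionGF]
    rw [Finset.sum_congr rfl fun i hi => by
      obtain ⟨e1, e2, e3, e4⟩ := herase x hx i hi h rfl
      rw [matchingGF_eq_completionGF 0 h _ _ e1 e2 e3 e4]]
    rw [← Finset.sum_mul, Finset.sum_card_filter_lt H fun k => (X : ℤ⟦X⟧) ^ (h - k), hH]
    have := sum_X_pow_sub 0 h
    rw [zero_add, pow_zero, one_mul] at this
    rw [this]
  | r + 1, 0 =>
    obtain ⟨x, hx, hmin⟩ := hnext (Finset.card_pos.1 (by omega))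
    obtain ⟨h1, h2, h3⟩ := hinsert x hx hmin
    rw [matchingGF_eq_add_sum (n := r) (by omega) hHS hx hmin hlow, completionGF,
      matchingGF_eq_completionGF r 1 _ _ (by omega) h2 h1 h3]
    obtain rfl : H = ∅ := Finset.card_eq_zero.1 hH
    simp
  | r + 1, h + 1 =>
    obtain ⟨x, hx, hmin⟩ := hnext (Finset.card_pos.1 (by omega))
    obtain ⟨h1, h2, h3⟩ := hinsert x hx hmin
    rw [matchingGF_eq_add_sum (n := r + 1 + h) (by omega) hHS hx hmin hlow, completionGF,
      matchingGF_eq_completionGF r (h + 2) _ _ (by omega) h2 h1 h3]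
    rw [Finset.sum_congr rfl fun i hi => by
      obtain ⟨e1, e2, e3, e4⟩ := herase x hx i hi h rfl
      rw [matchingGF_eq_completionGF (r + 1) h _ _ e1 e2 e3 e4]]
    rw [← Finset.sum_mul, Finset.sum_card_filter_lt H fun k => (X : ℤ⟦X⟧) ^ (r + 1 + h - k), hH,
      sum_X_pow_sub]
termination_by (r, h)

theorem ncard_perfectMatchings (n c : ℕ) (hc : c < n) (hc' : c ≤ n.choose 2) :
    Set.ncard {M : Finset (Finset ℕ) |
      IsPerfectMatching n M ∧ crossingCount M = n.choose 2 - c} = (n - 1 + c).choose c := by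
  have hGF := matchingGF_eq_completionGF n 0 (Finset.range (2 * n)) ∅ (by simp) rfl (by simp)
    (by simp)
  have hcoeff := coeff_completionGF n c hc
  rw [← hGF, matchingGF, map_sum] at hcoeff
  simp only [coeff_X_pow] at hcoeff
  rw [Finset.sum_boole] at hcoeff
  rw [← Nat.cast_inj (R := ℤ), ← hcoeff, Nat.cast_inj, ← Set.ncard_coe_finset]
  congr 1
  ext M
  simp only [Set.mem_ofPred_eq, Finset.coe_filter, mem_matchingsAvoiding, isPerfectMatching_iff]
  constructor
  · rintro ⟨hM, hcr⟩
    have h2 := hM.two_mul_card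
    rw [Finset.card_range] at h2
    obtain rfl : M.card = n := by omega
    refine ⟨⟨hM, fun p hp hpe => ?_⟩, by omega⟩
    have := hM.1 p hp
    rw [Finset.subset_empty.1 hpe] at this
    simp at this
  · rintro ⟨⟨hM, -⟩, hcr⟩
    have h2 := hM.two_mul_card
    rw [Finset.card_range] at h2
    obtain rfl : M.card = n := by omega
    have := crossingCount_le M
    exact ⟨hM, by omega⟩

end MatchingGF

theorem crossingCount_le_of_isDividingLine {n i j : ℕ} {M : Finset (Finset ℕ)}
    (hM : IsPerfectMatching n M) (h : IsDividingLine n i j M) :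
    crossingCount M + (n - 1) ≤ n.choose 2 := by
  classical
  obtain ⟨hi, hij, hjn, hT⟩ := h
  rw [isPerfectMatching_iff] at hM
  set T := Finset.Icc (2 * i - 1) (2 * j - 2) with hTdef
  have hTS : T ⊆ Finset.range (2 * n) := by
    intro x hx
    rw [hTdef, Finset.mem_Icc] at hx
    rw [Finset.mem_range]
    omega
  have hsplit : ∀ p ∈ M, p ⊆ T ∨ Disjoint p T := by
    intro p hp
    have h1 := hT p hp
    have h2 := hM.1 p hp
    have h3 := Finset.card_le_card (Finset.inter_subset_left : p ∩ T ⊆ p)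
    rcases Nat.eq_zero_or_pos (p ∩ T).card with h0 | h0
    · exact Or.inr (Finset.disjoint_iff_inter_eq_empty.2 (Finset.card_eq_zero.1 h0))
    · exact Or.inl (Finset.inter_eq_left.1
        (Finset.eq_of_subset_of_card_le Finset.inter_subset_left (by omega)))
  have hcard : 2 * (M.filter (· ⊆ T)).card = T.card := by
    rw [← hM.sum_card_inter hTS, ← Finset.sum_filter_add_sum_filter_not M (· ⊆ T),
      mul_comm, ← smul_eq_mul, ← Finset.sum_const,
      Finset.sum_eq_zero (s := M.filter fun p => ¬ p ⊆ T), add_zero]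
    · refine Finset.sum_congr rfl fun p hp => ?_
      rw [Finset.mem_filter] at hp
      rw [Finset.inter_eq_left.2 hp.2, hM.1 p hp.1]
    · intro p hp
      rw [Finset.mem_filter] at hp
      rw [Finset.card_eq_zero, ← Finset.disjoint_iff_inter_eq_empty]
      exact (hsplit p hp.1).resolve_left hp.2
  have hn := hM.two_mul_card
  rw [Finset.card_range] at hn
  have hTcard : T.card = 2 * (j - i) := by
    rw [hTdef, Nat.card_Icc]
    omega
  have hsum := Finset.card_filter_add_card_filter_not (s := M) (· ⊆ T)
  have hno : ∀ p q, p ⊆ T → Disjoint q T → ¬ Crosses p q := by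
    rintro p q hp hq ⟨a, b, c, d, h1, h2, h3, ⟨rfl, rfl⟩ | ⟨rfl, rfl⟩⟩
    · have ha := Finset.mem_Icc.1 (hp (show a ∈ ({a, b} : Finset ℕ) by simp))
      have hb := Finset.mem_Icc.1 (hp (show b ∈ ({a, b} : Finset ℕ) by simp))
      exact Finset.disjoint_left.1 hq (show c ∈ ({c, d} : Finset ℕ) by simp)
        (Finset.mem_Icc.2 (by omega))
    · have ha := Finset.mem_Icc.1 (hp (show c ∈ ({c, d} : Finset ℕ) by simp))
      have hb := Finset.mem_Icc.1 (hp (show d ∈ ({c, d} : Finset ℕ) by simp))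
      exact Finset.disjoint_left.1 hq (show b ∈ ({a, b} : Finset ℕ) by simp)
        (Finset.mem_Icc.2 (by omega))
  have hle : crossingCount M ≤ ((M.filter (· ⊆ T)).powersetCard 2 ∪
      (M.filter fun p => ¬ p ⊆ T).powersetCard 2).card := by
    rw [← Set.ncard_coe_finset]
    refine Set.ncard_le_ncard ?_ (Finset.finite_toSet _)
    rintro s ⟨p, hp, q, hq, h, rfl⟩
    have hne : p ≠ q := by
      rintro rfl
      exact not_crosses_self p h
    simp only [Finset.coe_union, Set.mem_union, Finset.mem_coe, Finset.mem_powersetCard,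
      Finset.card_pair hne, and_true, Finset.insert_subset_iff, Finset.singleton_subset_iff,
      Finset.mem_filter, hp, hq, true_and]
    by_cases hpT : p ⊆ T <;> by_cases hqT : q ⊆ T
    · exact Or.inl ⟨hpT, hqT⟩
    · exact absurd h (hno p q hpT ((hsplit q hq).resolve_left hqT))
    · exact absurd h.symm (hno q p hqT ((hsplit p hp).resolve_left hpT))
    · exact Or.inr ⟨hpT, hqT⟩
  have hle' := hle.trans (Finset.card_union_le _ _)
  rw [Finset.card_powersetCard, Finset.card_powersetCard] at hle'
  obtain ⟨a, ha⟩ : ∃ a, (M.filter (· ⊆ T)).card = a + 1 := ⟨j - i - 1, by omega⟩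
  obtain ⟨b, hb⟩ : ∃ b, (M.filter fun p => ¬ p ⊆ T).card = b + 1 := ⟨n - (j - i) - 1, by omega⟩
  obtain rfl : n = (a + 1) + (b + 1) := by omega
  rw [ha, hb] at hle'
  rw [Nat.add_choose_eq]
  simp only [Finset.Nat.antidiagonal_succ, Finset.Nat.antidiagonal_zero]
  simp
  nlinarith

/-- For `n ≥ 2` and `0 ≤ c ≤ n-2`, the number of full perfect matchings of `2n` points
on a circle with exactly `C(n,2) - c` crossing pairs equals `C(n-1+c, c)`. In
particular, every perfect matching of `2n` points with at least `C(n,2) - (n-2)`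
crossing pairs is full. -/
theorem count_full_matchings_high_rank (n : ℕ) (hn : 2 ≤ n) :
    (∀ c : ℕ, c ≤ n - 2 →
        Set.ncard {M : Finset (Finset ℕ) |
            IsPerfectMatching n M ∧ IsFull n M ∧
              crossingCount M = n.choose 2 - c} =
          (n - 1 + c).choose c) ∧
      ∀ M : Finset (Finset ℕ), IsPerfectMatching n M →
        n.choose 2 - (n - 2) ≤ crossingCount M → IsFull n M := by
  have hchoose : n - 1 ≤ n.choose 2 := by
    obtain ⟨d, rfl⟩ : ∃ d, n = d + 1 := ⟨n - 1, by omega⟩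
    rw [Nat.choose_succ_succ' d 1, Nat.choose_one_right]
    omega
  have hfull : ∀ M : Finset (Finset ℕ), IsPerfectMatching n M →
      n.choose 2 - (n - 2) ≤ crossingCount M → IsFull n M := by
    intro M hM hcr i j hdiv
    have := crossingCount_le_of_isDividingLine hM hdiv
    omega
  refine ⟨fun c hc => ?_, hfull⟩
  rw [← ncard_perfectMatchings n c (by omega) (by omega)]
  congr 1
  ext M
  simp only [Set.mem_ofPred_eq]
  exact ⟨fun h => ⟨h.1, h.2.2⟩, fun h => ⟨h.1, hfull M h.1 (by omega), h.2⟩⟩
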